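/- Let $G$ be a finitely presented group with $H_1(G)$ a torsion group. Then the deficiency of $G$ is at least the number of invariant factors of the Schur multiplier $H_2(G)$. Equivalently, for any presentation $\langle a_1, \ldots, a_n \mid r_1, \ldots, r_k \rangle$ of $G$, the difference $k - n$ is at least the number of invariant factors of $H_2(G)$. -/

import Mathlib

/-- The kernel of the canonical presentation `FreeGroup G → G`. -/
abbrev presKer (G : Type u) [Group G] : Subgroup (FreeGroup G) :=
  MonoidHom.ker (FreeGroup.lift (id : G → G))

/-- The Schur multiplier `H₂(G;ℤ)` of a group `G`, defined via Hopf's formula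
`H₂(G) ≅ (R ∩ [F,F]) / [F,R]` for the canonical presentation `G = F/R`,
`F = FreeGroup G`, `R = ker (F → G)`. -/
abbrev SchurMultiplier (G : Type u) [Group G] : Type u :=
  (presKer G ⊓ ⁅(⊤ : Subgroup (FreeGroup G)), (⊤ : Subgroup (FreeGroup G))⁆ :
      Subgroup (FreeGroup G)) ⧸
    ((⁅(⊤ : Subgroup (FreeGroup G)), presKer G⁆).subgroupOf
      (presKer G ⊓ ⁅(⊤ : Subgroup (FreeGroup G)), (⊤ : Subgroup (FreeGroup G))⁆))

/-- The number of invariant factors of an abelian (multiplicative) group `A`: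
the minimal number `r` of cyclic summands in a decomposition
`A ≅ ℤ/m₁ ⊕ ⋯ ⊕ ℤ/m_r` with `m₁ ∣ m₂ ∣ ⋯ ∣ m_r`. -/
noncomputable def invariantFactorCountMul (A : Type*) [Group A] : ℕ :=
  sInf {r : ℕ | ∃ m : Fin r → ℕ, (∀ i j : Fin r, i ≤ j → m i ∣ m j) ∧
    Nonempty (A ≃* Multiplicative ((i : Fin r) → ZMod (m i)))}

namespace ZMod

/-- Multiplication by `c` as a map `ℤ/a → ℤ/b`, where `b ∣ a * c`. -/
def mulHom (a b : ℕ) (c : ℤ) (h : (b : ℤ) ∣ a * c) : ZMod a →+ ZMod b :=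
  ZMod.lift a ⟨(zmultiplesHom (ZMod b)) (c : ZMod b), by
    have := (ZMod.intCast_zmod_eq_zero_iff_dvd _ _).2 h
    simpa using this⟩

theorem mulHom_intCast (a b : ℕ) (c : ℤ) (h : (b : ℤ) ∣ a * c) (x : ℤ) :
    mulHom a b c h x = ((x * c : ℤ) : ZMod b) := by
  simp [mulHom]

theorem nonempty_prod_addEquiv_gcd_lcm (a b : ℕ) :
    Nonempty (ZMod a × ZMod b ≃+ ZMod (a.gcd b) × ZMod (a.lcm b)) := by
  obtain hg | hg := (a.gcd b).eq_zero_or_pos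
  · obtain ⟨rfl, rfl⟩ := Nat.gcd_eq_zero_iff.1 hg
    exact ⟨AddEquiv.refl _⟩
  obtain ⟨a', b', hco, ha, hb⟩ := Nat.exists_coprime a b
  set g := a.gcd b with hgdef
  have hl1 : a.lcm b = a * b' := by
    apply Nat.eq_of_mul_eq_mul_left hg
    rw [hgdef, Nat.gcd_mul_lcm, ← hgdef]
    calc a * b = a * (b' * g) := by rw [← hb]
      _ = g * (a * b') := by ring
  have hl2 : a.lcm b = b * a' := by
    calc a.lcm b = a' * g * b' := by rw [hl1, ← ha]
      _ = b' * g * a' := by ring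
      _ = b * a' := by rw [← hb]
  obtain ⟨u, v, huv⟩ : IsCoprime (a' : ℤ) b' := Nat.isCoprime_iff_coprime.2 hco
  set l := a.lcm b with hl
  have ha' : (a : ℤ) = a' * g := by exact_mod_cast ha
  have hb' : (b : ℤ) = b' * g := by exact_mod_cast hb
  have hl1' : (l : ℤ) = a * b' := by exact_mod_cast hl1
  have hl2' : (l : ℤ) = b * a' := by exact_mod_cast hl2
  let f : ZMod a × ZMod b →+ ZMod g × ZMod l :=
    ((mulHom a g 1 ⟨a', by rw [ha']; ring⟩).coprod
      (mulHom b g 1 ⟨b', by rw [hb']; ring⟩)).prod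
    ((mulHom a l (-(v * b')) ⟨-v, by rw [hl1']; ring⟩).coprod
      (mulHom b l (u * a') ⟨u, by rw [hl2']; ring⟩))
  let f' : ZMod g × ZMod l →+ ZMod a × ZMod b :=
    ((mulHom g a (u * a') ⟨u, by rw [ha']; ring⟩).coprod
      (mulHom l a (-1) ⟨-b', by rw [hl1']; ring⟩)).prod
    ((mulHom g b (v * b') ⟨v, by rw [hb']; ring⟩).coprod
      (mulHom l b 1 ⟨a', by rw [hl2']; ring⟩))
  refine ⟨AddEquiv.mk' ⟨f, f', ?_, ?_⟩ f.map_add⟩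
  · rintro ⟨x, y⟩
    obtain ⟨x, rfl⟩ := ZMod.intCast_surjective x
    obtain ⟨y, rfl⟩ := ZMod.intCast_surjective y
    simp only [f, f', AddMonoidHom.prod_apply, AddMonoidHom.coprod_apply, mulHom_intCast,
      ← Int.cast_add]
    congr 2
    · linear_combination x * huv
    · linear_combination y * huv
  · rintro ⟨x, y⟩
    obtain ⟨x, rfl⟩ := ZMod.intCast_surjective x
    obtain ⟨y, rfl⟩ := ZMod.intCast_surjective y
    simp only [f, f', AddMonoidHom.prod_apply, AddMonoidHom.coprod_apply, mulHom_intCast,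
      ← Int.cast_add]
    congr 2
    · linear_combination x * huv
    · linear_combination y * huv

end ZMod

/-- Inserting a cyclic factor into a product of cyclic groups whose orders form a divisibility
chain gives again such a product. -/
theorem exists_dvd_chain_insert (r : ℕ) : ∀ (a : ℕ) (c : Fin r → ℕ), (∀ i j, i ≤ j → c i ∣ c j) →
    ∃ m : Fin (r + 1) → ℕ, (∀ i j, i ≤ j → m i ∣ m j) ∧
      (∀ d, d ∣ a → (∀ i, d ∣ c i) → ∀ i, d ∣ m i) ∧
      Nonempty ((ZMod a × ((i : Fin r) → ZMod (c i))) ≃+ ((i : Fin (r + 1)) → ZMod (m i))) := by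
  induction r with
  | zero =>
    intro a c _
    refine ⟨fun _ => a, fun _ _ _ => dvd_rfl, fun d h _ _ => h, ⟨?_⟩⟩
    exact AddEquiv.prodUnique.trans (AddEquiv.piUnique (fun _ : Fin 1 => ZMod a)).symm
  | succ r ih =>
    intro a c hc
    obtain ⟨m, hm, hd, ⟨e⟩⟩ := ih (a.lcm (c 0)) (fun i => c i.succ)
      fun i j hij => hc _ _ (Fin.succ_le_succ_iff.2 hij)
    obtain ⟨e'⟩ := ZMod.nonempty_prod_addEquiv_gcd_lcm a (c 0)
    have hg : ∀ i, a.gcd (c 0) ∣ m i := hd _ ((Nat.gcd_dvd_left _ _).trans (Nat.dvd_lcm_left _ _)) fun i =>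
      (Nat.gcd_dvd_right _ _).trans (hc _ _ (Fin.zero_le _))
    refine ⟨Fin.cons (a.gcd (c 0)) m, ?_, ?_, ⟨?_⟩⟩
    · intro i j
      refine Fin.cases (fun _ => ?_) (fun i => ?_) i
      · refine Fin.cases dvd_rfl (fun j => ?_) j
        simpa using hg j
      · refine Fin.cases (fun h => ?_) (fun j h => ?_) j
        · simp at h
        · simpa using hm i j (by simpa using h)
    · intro d h1 h2 i
      refine Fin.cases ?_ (fun i => ?_) i
      · simpa using Nat.dvd_gcd h1 (h2 0)
      · simpa using hd d (h1.trans (Nat.dvd_lcm_left _ _)) (fun i => h2 _) i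
    · exact ((AddEquiv.refl _).prodCongr
          (Fin.consLinearEquiv ℤ fun i => ZMod (c i)).toAddEquiv.symm).trans <|
        AddEquiv.prodAssoc.symm.trans <| (e'.prodCongr (AddEquiv.refl _)).trans <|
        AddEquiv.prodAssoc.trans <| ((AddEquiv.refl _).prodCongr e).trans
        (Fin.consLinearEquiv ℤ fun i => ZMod ((Fin.cons (a.gcd (c 0)) m : Fin _ → ℕ) i)).toAddEquiv

/-- A finite product of cyclic groups is isomorphic to a product with the same number of factors,
whose orders form a divisibility chain. -/
theorem exists_dvd_chain (r : ℕ) : ∀ a : Fin r → ℕ,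
    ∃ m : Fin r → ℕ, (∀ i j, i ≤ j → m i ∣ m j) ∧
      Nonempty (((i : Fin r) → ZMod (a i)) ≃+ ((i : Fin r) → ZMod (m i))) := by
  induction r with
  | zero => exact fun a => ⟨a, fun i => i.elim0, ⟨AddEquiv.refl _⟩⟩
  | succ r ih =>
    intro a
    obtain ⟨m, hm, ⟨e⟩⟩ := ih fun i => a i.succ
    obtain ⟨m', hm', -, ⟨e'⟩⟩ := exists_dvd_chain_insert r (a 0) m hm
    exact ⟨m', hm', ⟨(Fin.consLinearEquiv ℤ fun i => ZMod (a i)).toAddEquiv.symm.trans <|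
      ((AddEquiv.refl _).prodCongr e).trans e'⟩⟩

/-- Every subgroup of `ℤ^r` is the kernel of a surjection onto a product of `r` cyclic groups. -/
theorem exists_pi_zmod_ker_eq (r : ℕ) (N : Submodule ℤ (Fin r → ℤ)) :
    ∃ (a : Fin r → ℕ) (g : (Fin r → ℤ) →+ ((i : Fin r) → ZMod (a i))),
      Function.Surjective g ∧ g.ker = N.toAddSubgroup := by
  classical
  obtain ⟨t, S⟩ := N.smithNormalForm (Pi.basisFun ℤ (Fin r))
  let c : Fin r → ℤ := fun i => ∑ j, if S.f j = i then S.a j else 0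
  have hc : ∀ j, c (S.f j) = S.a j := fun j => by simp [c]
  have hc' : ∀ i, i ∉ Set.range S.f → c i = 0 := fun i hi =>
    Finset.sum_eq_zero fun j _ => if_neg fun h => hi ⟨j, h⟩
  let g : (Fin r → ℤ) →+ ((i : Fin r) → ZMod (c i).natAbs) := AddMonoidHom.mk'
    (fun v i => (S.bM.repr v i : ZMod (c i).natAbs)) (fun v w => by ext i; simp)
  have hg : ∀ v, g v = 0 ↔ ∀ i, c i ∣ S.bM.repr v i := fun v => by
    simp only [g, funext_iff, AddMonoidHom.mk'_apply, Pi.zero_apply,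
      ZMod.intCast_zmod_eq_zero_iff_dvd, Int.natCast_natAbs, abs_dvd]
  refine ⟨_, g, fun y => ?_, ?_⟩
  · choose z hz using fun i => ZMod.intCast_surjective (y i)
    refine ⟨S.bM.equivFun.symm z, funext fun i => ?_⟩
    change ((S.bM.equivFun (S.bM.equivFun.symm z) i : ℤ) : ZMod (c i).natAbs) = y i
    rw [LinearEquiv.apply_symm_apply, hz]
  · ext v
    rw [AddMonoidHom.mem_ker, hg, Submodule.mem_toAddSubgroup]
    constructor
    · intro h
      choose q hq using h
      rw [← S.bM.sum_repr v]
      refine Submodule.sum_mem _ fun i _ => ?_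
      by_cases hi : i ∈ Set.range S.f
      · obtain ⟨j, rfl⟩ := hi
        rw [hq, hc, mul_comm, mul_smul, ← S.snf]
        exact N.smul_mem _ (S.bN j).2
      · simp [hq, hc' i hi]
    · intro h i
      by_cases hi : i ∈ Set.range S.f
      · obtain ⟨j, rfl⟩ := hi
        rw [hc]
        exact ⟨_, congrFun (S.repr_comp_embedding_eq_smul ⟨v, h⟩) j⟩
      · have := S.repr_eq_zero_of_notMem_range ⟨v, h⟩ hi
        simp only at this
        rw [this]; exact dvd_zero _

theorem invariantFactorCountMul_le_of_surjective {A : Type*} [Group A] (r : ℕ)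
    (f : Multiplicative (Fin r → ℤ) →* A) (hf : Function.Surjective f) :
    invariantFactorCountMul A ≤ r := by
  apply Nat.sInf_le
  obtain ⟨a, g, hg, hk⟩ := exists_pi_zmod_ker_eq r
    (AddSubgroup.toIntSubmodule (Subgroup.toAddSubgroup' f.ker))
  obtain ⟨m, hm, ⟨e⟩⟩ := exists_dvd_chain r a
  refine ⟨m, hm, ⟨(QuotientGroup.quotientKerEquivOfSurjective f hf).symm.trans <|
    (QuotientGroup.quotientMulEquivOfEq ?_).trans <|
    (QuotientGroup.quotientKerEquivOfSurjective g.toMultiplicative hg).trans e.toMultiplicative⟩⟩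
  ext x
  exact (SetLike.ext_iff.1 hk x.toAdd).symm

theorem mk_mem_center {F : Type*} [Group F] {R : Subgroup F} [R.Normal] {x : F} (hx : x ∈ R) :
    (QuotientGroup.mk x : F ⧸ ⁅(⊤ : Subgroup F), R⁆) ∈ Subgroup.center _ := by
  rw [Subgroup.mem_center_iff]
  intro q
  obtain ⟨y, rfl⟩ := QuotientGroup.mk_surjective q
  rw [← QuotientGroup.mk_mul, ← QuotientGroup.mk_mul, QuotientGroup.eq_iff_div_mem,
    div_eq_mul_inv, mul_inv_rev, ← mul_assoc]
  exact Subgroup.commutator_mem_commutator (Subgroup.mem_top y) hx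

open scoped IsMulCommutative in
/-- If `e` maps the elements `rel i` to the center, then the image of their normal closure is the
image of `ℤ^k`. -/
theorem Subgroup.exists_range_eq_map_normalClosure {H Q : Type*} [Group H] [Group Q] {k : ℕ}
    (rel : Fin k → H) (e : H →* Q) (he : ∀ i, e (rel i) ∈ Subgroup.center Q) :
    ∃ P : Multiplicative (Fin k → ℤ) →* Q,
      P.range = (Subgroup.normalClosure (Set.range rel)).map e := by
  let p : (Fin k → ℤ) →ₗ[ℤ] Additive (Subgroup.center Q) :=
    Fintype.linearCombination ℤ fun i => Additive.ofMul ⟨e (rel i), he i⟩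
  let P : Multiplicative (Fin k → ℤ) →* Q :=
    (Subgroup.center Q).subtype.comp (AddMonoidHom.toMultiplicativeLeft p.toAddMonoidHom)
  have hP : ∀ c, P c ∈ Subgroup.center Q := fun c => Subtype.property _
  refine ⟨P, le_antisymm ?_ ?_⟩
  · rintro _ ⟨c, rfl⟩
    have h : p c.toAdd ∈ (((Subgroup.normalClosure (Set.range rel)).map e).comap
        (Subgroup.center Q).subtype).toAddSubgroup := by
      rw [Fintype.linearCombination_apply]
      refine AddSubgroup.sum_mem _ fun i _ => AddSubgroup.zsmul_mem _ ?_ _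
      exact Subgroup.mem_map_of_mem e (Subgroup.subset_normalClosure ⟨i, rfl⟩)
    exact h
  · have : P.range.Normal := ⟨by
      rintro _ ⟨c, rfl⟩ q
      rw [Subgroup.mem_center_iff.1 (hP c) q, mul_inv_cancel_right]
      exact ⟨c, rfl⟩⟩
    rw [Subgroup.map_le_iff_le_comap]
    apply Subgroup.normalClosure_le_normal
    rintro _ ⟨i, rfl⟩
    refine ⟨Multiplicative.ofAdd (Pi.single i 1), ?_⟩
    change ((p (Pi.single i 1)).toMul : Q) = _
    simp [p]

/-- The rank of the kernel of a map from `ℤ^k` with torsion cokernel. -/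
theorem finrank_ker_of_isTorsion_quotient {M : Type*} [AddCommGroup M] [Module.Finite ℤ M]
    {k : ℕ} (T : (Fin k → ℤ) →ₗ[ℤ] M) (hT : ∀ v, ∃ j : ℕ, 0 < j ∧ j • v ∈ LinearMap.range T) :
    Module.finrank ℤ (LinearMap.ker T) = k - Module.finrank ℤ M := by
  have h1 := Submodule.finrank_quotient_add_finrank (LinearMap.ker T)
  rw [T.quotKerEquivRange.finrank_eq, Module.finrank_fin_fun] at h1
  have h2 := Submodule.finrank_quotient_add_finrank (LinearMap.range T)
  have h3 : Module.finrank ℤ (M ⧸ LinearMap.range T) = 0 := by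
    rw [Module.finrank_eq_zero_iff_isTorsion]
    intro x
    obtain ⟨v, rfl⟩ := Submodule.Quotient.mk_surjective _ x
    obtain ⟨j, hj, h⟩ := hT v
    refine ⟨⟨j, by simpa using hj.ne'⟩, ?_⟩
    rw [Submonoid.mk_smul, ← Submodule.Quotient.mk_smul, Submodule.Quotient.mk_eq_zero]
    simpa using h
  omega

open scoped IsMulCommutative in
/-- An endomorphism `h` of `F` which is the identity modulo `R` is the identity on
`[F, F]` modulo `[F, R]`. -/
theorem mk_apply_eq_of_mem_commutator {F : Type*} [Group F] {R : Subgroup F} [R.Normal]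
    (h : F →* F) (hR : ∀ x, h x * x⁻¹ ∈ R) {x : F}
    (hx : x ∈ ⁅(⊤ : Subgroup F), (⊤ : Subgroup F)⁆) :
    (QuotientGroup.mk (h x) : F ⧸ ⁅(⊤ : Subgroup F), R⁆) = QuotientGroup.mk x := by
  have hc : ∀ x, (QuotientGroup.mk (h x * x⁻¹) : F ⧸ ⁅(⊤ : Subgroup F), R⁆) ∈
    Subgroup.center _ := fun x => mk_mem_center (hR x)
  let δ : F →* Subgroup.center (F ⧸ ⁅(⊤ : Subgroup F), R⁆) :=
    MonoidHom.mk' (fun x => ⟨QuotientGroup.mk (h x * x⁻¹), hc x⟩) fun x y => by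
      ext
      have := Subgroup.mem_center_iff.1 (hc y) (QuotientGroup.mk (x⁻¹))
      simp only [QuotientGroup.mk_mul, map_mul, mul_inv_rev, QuotientGroup.mk_inv, Subgroup.coe_mul]
        at this ⊢
      simp only [mul_assoc] at this ⊢
      rw [this]
  have hδ : ⁅(⊤ : Subgroup F), (⊤ : Subgroup F)⁆ ≤ δ.ker := Abelianization.commutator_subset_ker δ
  have : (QuotientGroup.mk (h x * x⁻¹) : F ⧸ ⁅(⊤ : Subgroup F), R⁆) = 1 :=
    Subtype.ext_iff.1 (MonoidHom.mem_ker.1 (hδ hx))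
  rwa [QuotientGroup.mk_mul, QuotientGroup.mk_inv, mul_inv_eq_one] at this


/-- If `φ : F → G` is surjective and `G` has torsion abelianization, then the image of `ker φ` in
the abelianization of `F` has torsion quotient. -/
theorem exists_pow_mem_map_of_ker {F G : Type*} [Group F] [Group G] (φ : F →* G)
    (hsurj : Function.Surjective φ) (htors : ∀ x : Abelianization G, ∃ j : ℕ, 0 < j ∧ x ^ j = 1)
    (x : Abelianization F) : ∃ j : ℕ, 0 < j ∧ x ^ j ∈ φ.ker.map Abelianization.of := by
  obtain ⟨u, rfl⟩ := QuotientGroup.mk_surjective x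
  obtain ⟨j, hj, h⟩ := htors (Abelianization.of (φ u))
  rw [← map_pow, ← map_pow, ← MonoidHom.mem_ker, Abelianization.ker_of, commutator_def,
    ← Subgroup.map_top_of_surjective φ hsurj, ← Subgroup.map_commutator] at h
  obtain ⟨w, hw, hwu⟩ := h
  rw [SetLike.mem_coe, ← commutator_def, ← Abelianization.ker_of, MonoidHom.mem_ker] at hw
  refine ⟨j, hj, u ^ j * w⁻¹, ?_, ?_⟩
  · rw [SetLike.mem_coe, MonoidHom.mem_ker, map_mul, map_inv, hwu, mul_inv_cancel]
  · rw [map_mul, map_inv, hw, inv_one, mul_one, map_pow]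
    rfl

/-- Let `G` be a finitely presented group whose abelianization `H₁(G)` is a torsion group.
For any finite presentation of `G` with `n` generators and `k` relators, the deficiency
`k - n` is at least the number of invariant factors of the Schur multiplier `H₂(G)`. -/
theorem deficiency_ge_invariantFactorCount_schurMultiplier
    (G : Type) [Group G] (n k : ℕ) (rel : Fin k → FreeGroup (Fin n))
    (φ : FreeGroup (Fin n) →* G) (hsurj : Function.Surjective φ)
    (hker : MonoidHom.ker φ = Subgroup.normalClosure (Set.range rel))
    (htors : ∀ x : Abelianization G, ∃ j : ℕ, 0 < j ∧ x ^ j = 1) :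
    invariantFactorCountMul (SchurMultiplier G) ≤ k - n := by
  let π : FreeGroup G →* G := FreeGroup.lift id
  let L : Subgroup (FreeGroup G) := ⁅(⊤ : Subgroup (FreeGroup G)), presKer G⁆
  let f : FreeGroup G →* FreeGroup (Fin n) := FreeGroup.lift (Function.surjInv hsurj)
  let g : FreeGroup (Fin n) →* FreeGroup G := FreeGroup.lift fun i => FreeGroup.of (φ (FreeGroup.of i))
  have hf : ∀ x, φ (f x) = π x := DFunLike.congr_fun
    (FreeGroup.ext_hom (φ.comp f) π fun x => by simp [f, π, Function.surjInv_eq])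
  have hg : ∀ x, π (g x) = φ x := DFunLike.congr_fun
    (FreeGroup.ext_hom (π.comp g) φ fun x => by simp [g, π])
  let e : FreeGroup (Fin n) →* (FreeGroup G ⧸ L) × Abelianization (FreeGroup (Fin n)) :=
    ((QuotientGroup.mk' L).comp g).prod Abelianization.of
  have hrel : ∀ i, e (rel i) ∈ Subgroup.center _ := fun i => by
    rw [Subgroup.center_prod, CommGroup.center_eq_top, Subgroup.mem_prod]
    refine ⟨mk_mem_center ?_, Subgroup.mem_top _⟩
    have : rel i ∈ φ.ker := hker ▸ Subgroup.subset_normalClosure ⟨i, rfl⟩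
    exact (hg _).trans this
  obtain ⟨P, hP⟩ := Subgroup.exists_range_eq_map_normalClosure rel e hrel
  rw [← hker] at hP
  let E : Additive (Abelianization (FreeGroup (Fin n))) ≃+ (Fin n →₀ ℤ) :=
    FreeAbelianGroup.equivFinsupp (Fin n)
  let T : (Fin k → ℤ) →ₗ[ℤ] (Fin n →₀ ℤ) := AddMonoidHom.toIntLinearMap
    (E.toAddMonoidHom.comp (MonoidHom.toAdditiveRight ((MonoidHom.snd _ _).comp P)))
  have hT : ∀ c, T c = E (Additive.ofMul (P (Multiplicative.ofAdd c)).2) := fun _ => rfl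
  have hTker : ∀ c, c ∈ LinearMap.ker T ↔ (P (Multiplicative.ofAdd c)).2 = 1 := fun c => by
    rw [LinearMap.mem_ker, hT, map_eq_zero_iff E E.injective, ofMul_eq_zero]
  have hrank : Module.finrank ℤ (LinearMap.ker T) = k - n := by
    rw [finrank_ker_of_isTorsion_quotient T, Module.finrank_finsupp_self, Fintype.card_fin]
    intro v
    obtain ⟨j, hj, w, hw, hwv⟩ := exists_pow_mem_map_of_ker φ hsurj htors (E.symm v).toMul
    obtain ⟨c, hc⟩ : e w ∈ P.range := hP ▸ ⟨w, hw, rfl⟩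
    refine ⟨j, hj, c.toAdd, ?_⟩
    rw [hT, ofAdd_toAdd, hc]
    change E (Additive.ofMul (Abelianization.of w)) = _
    rw [hwv, ofMul_pow, ofMul_toMul, map_nsmul, E.apply_symm_apply]
  let b := Module.finBasisOfFinrankEq ℤ (LinearMap.ker T) hrank
  let s : Multiplicative (Fin (k - n) → ℤ) →* FreeGroup G ⧸ L :=
    ((MonoidHom.fst _ _).comp P).comp (AddMonoidHom.toMultiplicative
      ((LinearMap.ker T).subtype.comp b.equivFun.symm.toLinearMap).toAddMonoidHom)
  have hs : ∀ c : LinearMap.ker T, s (Multiplicative.ofAdd (b.equivFun c)) =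
      (P (Multiplicative.ofAdd (c : Fin k → ℤ))).1 := fun c => by
    change (P (Multiplicative.ofAdd ((b.equivFun.symm (b.equivFun c) : LinearMap.ker T) :
      Fin k → ℤ))).1 = _
    rw [LinearEquiv.symm_apply_apply]
  let N : Subgroup (FreeGroup G) := presKer G ⊓ ⁅(⊤ : Subgroup (FreeGroup G)), (⊤ : Subgroup (FreeGroup G))⁆
  let h : N →* FreeGroup G ⧸ L := (QuotientGroup.mk' L).comp N.subtype
  have hh : L.subgroupOf N = h.ker := by
    rw [← MonoidHom.comap_ker, QuotientGroup.ker_mk']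
    rfl
  have hrange : s.range = h.range := by
    apply le_antisymm
    · rintro _ ⟨c, rfl⟩
      obtain ⟨c, rfl⟩ := (b.equivFun.toEquiv.trans Multiplicative.ofAdd).surjective c
      obtain ⟨w, hw, hwc⟩ : P (Multiplicative.ofAdd (c : Fin k → ℤ)) ∈ φ.ker.map e := hP ▸ ⟨_, rfl⟩
      have hw1 : w ∈ commutator (FreeGroup (Fin n)) := by
        rw [← Abelianization.ker_of]
        exact (congrArg Prod.snd hwc).trans ((hTker c).1 c.2)
      have hgw : g w ∈ ⁅(⊤ : Subgroup (FreeGroup G)), (⊤ : Subgroup (FreeGroup G))⁆ :=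
        (Subgroup.map_commutator _ _ g).trans_le
          (Subgroup.commutator_mono le_top le_top) ⟨w, hw1, rfl⟩
      exact ⟨⟨g w, (hg w).trans hw, hgw⟩, (congrArg Prod.fst hwc).trans (hs c).symm⟩
    · rintro _ ⟨⟨x, hxR, hxC⟩, rfl⟩
      have hfx : f x ∈ φ.ker := (hf x).trans hxR
      obtain ⟨c, hc⟩ : e (f x) ∈ P.range := hP ▸ ⟨f x, hfx, rfl⟩
      have hcT : c.toAdd ∈ LinearMap.ker T := by
        rw [hTker, ofAdd_toAdd, hc]
        exact (Abelianization.commutator_subset_ker (Abelianization.of.comp f)) hxC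
      refine ⟨_, (hs ⟨_, hcT⟩).trans ?_⟩
      rw [ofAdd_toAdd, hc]
      refine mk_apply_eq_of_mem_commutator (g.comp f) (fun y => ?_) hxC
      change π _ = 1
      rw [map_mul, map_inv, MonoidHom.comp_apply, hg, hf, mul_inv_cancel]
  let i : SchurMultiplier G ≃* s.range :=
    (QuotientGroup.quotientMulEquivOfEq hh).trans <|
      (QuotientGroup.quotientKerEquivRange h).trans (MulEquiv.subgroupCongr hrange.symm)
  exact invariantFactorCountMul_le_of_surjective _ (i.symm.toMonoidHom.comp s.rangeRestrict)
    (i.symm.surjective.comp s.rangeRestrict_surjective)
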